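/- Let n ≥ 1, let Ω ⊆ ℝ^{n+1} be open and let f ∈ L¹_loc(Ω,𝒜) satisfy D̄f = 0 in the weak sense, i.e. ∫_Ω (αD̄) f dx = 0 for every α ∈ C_c^∞(Ω,𝒜). Then f is (almost everywhere equal to) a smooth function on Ω which is left-monogenic at every point of Ω, i.e. satisfies D̄f = 0 in the classical sense. -/

import Mathlib

open MeasureTheory

noncomputable section

/-- `ℝ^{n+1}` with coordinates `x₀, …, xₙ`. -/
abbrev RV (n : ℕ) : Type := Fin (n + 1) → ℝ

/-- The real Clifford algebra `𝒜` generated by `e₁, …, eₙ` (with `eᵢ² = -1`),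
presented by its coefficients over the basis `{e_A : A ⊆ {1,…,n}}`. -/
abbrev CA (n : ℕ) : Type := Finset (Fin n) → ℝ

namespace CA

variable {n : ℕ}

/-- The sign occurring in the product `e_A · e_B = msign A B • e_{A Δ B}`. -/
def msign (A B : Finset (Fin n)) : ℝ :=
  (-1 : ℝ) ^ (((A ×ˢ B).filter fun p => p.2 < p.1).card + (A ∩ B).card)

/-- Clifford multiplication, written on coefficients. -/
def cmul (a b : CA n) : CA n := fun C =>
  ∑ A : Finset (Fin n), ∑ B : Finset (Fin n),
    if symmDiff A B = C then msign A B * a A * b B else 0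

/-- The conjugation `ā = Σ_A a_A ē_A`, `ē_A = (-1)^{|A|(|A|+1)/2} e_A`. -/
def conj (a : CA n) : CA n := fun A => (-1 : ℝ) ^ (A.card * (A.card + 1) / 2) * a A

/-- The scalar part `[a]₀`. -/
def scalarPart (a : CA n) : ℝ := a ∅

/-- `|a|₀² = 2ⁿ Σ_A a_A²`. -/
def normSq (a : CA n) : ℝ := 2 ^ n * ∑ A : Finset (Fin n), (a A) ^ 2

/-- `|a|₀`. -/
def norm0 (a : CA n) : ℝ := Real.sqrt (normSq a)

/-- The unit `e₀ = 1`. -/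
def one : CA n := fun A => if A = ∅ then 1 else 0

/-- The generator `eᵢ`, `1 ≤ i ≤ n`. -/
def gen (i : Fin n) : CA n := fun A => if A = {i} then 1 else 0

/-- `e_i` for `i : Fin (n+1)`: `e_0 = 1` and `e_i` a generator for `i ≥ 1`. -/
def eV : Fin (n + 1) → CA n
  | ⟨0, _⟩ => one
  | ⟨k + 1, hk⟩ => gen ⟨k, Nat.succ_lt_succ_iff.mp hk⟩

/-- `ēᵢ`: `ē₀ = 1`, `ēᵢ = -eᵢ` for `i ≥ 1`. -/
def eVbar (i : Fin (n + 1)) : CA n := conj (eV i)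

end CA

/-- The partial derivative `∂F/∂xᵢ` of an `𝒜`-valued function, componentwise. -/
def pd {n : ℕ} (F : RV n → CA n) (i : Fin (n + 1)) (x : RV n) : CA n :=
  fun A => fderiv ℝ (fun y => F y A) x (Pi.single i 1)

/-- The Dirac operator acting from the left: `D̄F = Σᵢ eᵢ ∂F/∂xᵢ`. -/
def DiracL {n : ℕ} (F : RV n → CA n) (x : RV n) : CA n :=
  ∑ i : Fin (n + 1), CA.cmul (CA.eV i) (pd F i x)

/-- The Dirac operator acting from the right: `FD̄ = Σᵢ (∂F/∂xᵢ) eᵢ`. -/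
def DiracR {n : ℕ} (F : RV n → CA n) (x : RV n) : CA n :=
  ∑ i : Fin (n + 1), CA.cmul (pd F i x) (CA.eV i)

/-- The conjugate operator acting from the left: `DF = Σᵢ ēᵢ ∂F/∂xᵢ`. -/
def DconjL {n : ℕ} (F : RV n → CA n) (x : RV n) : CA n :=
  ∑ i : Fin (n + 1), CA.cmul (CA.eVbar i) (pd F i x)

/-- The conjugate operator acting from the right: `FD = Σᵢ (∂F/∂xᵢ) ēᵢ`. -/
def DconjR {n : ℕ} (F : RV n → CA n) (x : RV n) : CA n :=
  ∑ i : Fin (n + 1), CA.cmul (pd F i x) (CA.eVbar i)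

/-- Partial derivative of a real-valued function. -/
def pdR {n : ℕ} (φ : RV n → ℝ) (i : Fin (n + 1)) (x : RV n) : ℝ :=
  fderiv ℝ φ x (Pi.single i 1)

/-- Second partial derivative `∂²φ/∂xᵢ∂xⱼ`. -/
def pdR2 {n : ℕ} (φ : RV n → ℝ) (i j : Fin (n + 1)) (x : RV n) : ℝ :=
  fderiv ℝ (fun y => fderiv ℝ φ y (Pi.single j 1)) x (Pi.single i 1)

/-- The Laplacian `Δφ = Σᵢ ∂²φ/∂xᵢ²`. -/
def lap {n : ℕ} (φ : RV n → ℝ) (x : RV n) : ℝ := ∑ i : Fin (n + 1), pdR2 φ i i x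

/-- `Dφ = ∂φ/∂x₀ - Σ_{i≥1} eᵢ ∂φ/∂xᵢ` as a Clifford-algebra-valued function. -/
def Dgrad {n : ℕ} (φ : RV n → ℝ) (x : RV n) : CA n :=
  ∑ i : Fin (n + 1), pdR φ i x • CA.eVbar i

/-- The dual operator `D̄*_φ α = α (Dφ) - Dα`. -/
def dualOp {n : ℕ} (φ : RV n → ℝ) (α : RV n → CA n) (x : RV n) : CA n :=
  CA.cmul (α x) (Dgrad φ x) - DconjL α x

/-- `α ∈ C_c^∞(Ω, 𝒜)`. -/
def IsTest {n : ℕ} (Ω : Set (RV n)) (α : RV n → CA n) : Prop :=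
  ContDiff ℝ (⊤ : ℕ∞) α ∧ HasCompactSupport α ∧ tsupport α ⊆ Ω

/-- `f ∈ L²(Ω, 𝒜, φ)`: measurable with `∫_Ω |f|₀² e^{-φ} dx < ∞`. -/
def MemL2w {n : ℕ} (Ω : Set (RV n)) (φ : RV n → ℝ) (f : RV n → CA n) : Prop :=
  AEStronglyMeasurable f (volume.restrict Ω) ∧
  Integrable (fun x => CA.normSq (f x) * Real.exp (-φ x)) (volume.restrict Ω)

/-- `u` is a weak solution of `D̄u = f` on `Ω`:
`∫_Ω α f dx = -∫_Ω (α D̄) u dx` for all `α ∈ C_c^∞(Ω, 𝒜)`. -/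
def IsWeakSol {n : ℕ} (Ω : Set (RV n)) (u f : RV n → CA n) : Prop :=
  ∀ α : RV n → CA n, IsTest Ω α →
    ∫ x in Ω, CA.cmul (α x) (f x) = -∫ x in Ω, CA.cmul (DiracR α x) (u x)

/-- The `𝒜`-valued inner product `(f,g)_φ = ∫_Ω f̄ g e^{-φ} dx`. -/
def innerW {n : ℕ} (Ω : Set (RV n)) (φ : RV n → ℝ) (f g : RV n → CA n) : CA n :=
  ∫ x in Ω, Real.exp (-φ x) • CA.cmul (CA.conj (f x)) (g x)


namespace WM

open CA Finset

variable {n : ℕ}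

/-- The basis element `e_A`. -/
def bas (A : Finset (Fin n)) : CA n := fun B => if B = A then 1 else 0

/-- Clifford multiplication as a bilinear map. -/
def cmulL : CA n →ₗ[ℝ] CA n →ₗ[ℝ] CA n :=
  LinearMap.mk₂ ℝ cmul
    (by
      intro a b c; funext C
      simp only [cmul, Pi.add_apply, ← Finset.sum_add_distrib]
      refine Finset.sum_congr rfl fun A _ => Finset.sum_congr rfl fun B _ => ?_
      split_ifs <;> ring)
    (by
      intro r b c; funext C
      simp only [cmul, Pi.smul_apply, smul_eq_mul, Finset.mul_sum]
      refine Finset.sum_congr rfl fun A _ => Finset.sum_congr rfl fun B _ => ?_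
      split_ifs <;> ring)
    (by
      intro a b c; funext C
      simp only [cmul, Pi.add_apply, ← Finset.sum_add_distrib]
      refine Finset.sum_congr rfl fun A _ => Finset.sum_congr rfl fun B _ => ?_
      split_ifs <;> ring)
    (by
      intro r b c; funext C
      simp only [cmul, Pi.smul_apply, smul_eq_mul, Finset.mul_sum]
      refine Finset.sum_congr rfl fun A _ => Finset.sum_congr rfl fun B _ => ?_
      split_ifs <;> ring)

lemma cmul_eq (a b : CA n) : cmul a b = cmulL a b := rfl

lemma cmul_bas (A B : Finset (Fin n)) :
    cmul (bas A) (bas B) = msign A B • bas (symmDiff A B) := by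
  funext C
  simp only [cmul, bas, Pi.smul_apply, smul_eq_mul]
  rw [Finset.sum_eq_single A, Finset.sum_eq_single B]
  · simp [eq_comm]
  · intro b _ hb; simp [hb]
  · simp
  · intro b _ hb; simp [hb]
  · simp

lemma one_cmul (a : CA n) : cmul one a = a := by
  funext C
  simp only [cmul, one]
  rw [Finset.sum_eq_single ∅, Finset.sum_eq_single C]
  · simp [msign]
  · intro b _ hb
    have : symmDiff ∅ b ≠ C := by
      have : symmDiff (∅ : Finset (Fin n)) b = b := bot_symmDiff b
      rw [this]; exact hb
    simp [this]
  · simp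
  · intro b _ hb; simp [hb]
  · simp

lemma eV_zero : (eV 0 : CA n) = bas ∅ := rfl
lemma eV_succ (k : Fin n) : (eV k.succ : CA n) = bas {k} := rfl
lemma one_eq : (one : CA n) = bas ∅ := rfl

lemma conj_bas (A : Finset (Fin n)) :
    conj (bas A) = ((-1 : ℝ) ^ (A.card * (A.card + 1) / 2)) • bas A := by
  funext B
  simp only [conj, bas, Pi.smul_apply, smul_eq_mul]
  split_ifs with h
  · rw [h]
  · simp

lemma eVbar_zero : (eVbar 0 : CA n) = bas ∅ := by
  rw [eVbar, eV_zero, conj_bas]; simp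

lemma eVbar_succ (k : Fin n) : (eVbar k.succ : CA n) = -bas {k} := by
  rw [eVbar, eV_succ, conj_bas]; simp

lemma msign_single (i j : Fin n) :
    msign {i} {j} = if j ≤ i then -1 else 1 := by
  rcases lt_trichotomy i j with h | h | h
  · have h1 : ¬ j ≤ i := not_le.2 h
    have h2 : ¬ j < i := not_lt.2 h.le
    simp [msign, h1, h2, Finset.filter_singleton, h.ne]
  · subst h
    simp [msign, Finset.filter_singleton]
  · simp [msign, h, h.le, Finset.filter_singleton, h.ne']

lemma anticomm (i j : Fin (n + 1)) :
    cmul (eVbar j) (eV i) + cmul (eVbar i) (eV j) = if i = j then (2 : ℝ) • (one : CA n) else 0 := by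
  have e1 : ∀ B : Finset (Fin n), symmDiff ∅ B = B := fun B => bot_symmDiff B
  have e2 : ∀ B : Finset (Fin n), symmDiff B ∅ = B := fun B => symmDiff_bot B
  have neg : ∀ a b : CA n, cmul (-a) b = - cmul a b := by
    intro a b; rw [cmul_eq, cmul_eq, map_neg]; rfl
  have m1 : ∀ B : Finset (Fin n), msign ∅ B = 1 := fun B => by simp [msign]
  have m2 : ∀ B : Finset (Fin n), msign B ∅ = 1 := fun B => by simp [msign]
  refine Fin.cases ?_ (fun i => ?_) i <;> refine Fin.cases ?_ (fun j => ?_) j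
  · rw [eV_zero, eVbar_zero, cmul_bas, e1, m1]
    simp [one_eq, two_smul]
  · rw [eV_zero, eVbar_zero, eV_succ, eVbar_succ, neg, cmul_bas, cmul_bas, e1, e2, m1, m2]
    simp [(Fin.succ_ne_zero j).symm]
  · rw [eV_zero, eVbar_zero, eV_succ, eVbar_succ, neg, cmul_bas, cmul_bas, e1, e2, m1, m2]
    simp [(Fin.succ_ne_zero i)]
  · rw [eV_succ, eVbar_succ, eV_succ, eVbar_succ, neg, neg, cmul_bas, cmul_bas, msign_single,
      msign_single, symmDiff_comm]
    rcases lt_trichotomy i j with h | h | h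
    · have : ¬ j ≤ i := not_le.2 h
      simp [this, h.le, h.ne]
    · subst h
      simp [one_eq, two_smul]
    · have : ¬ i ≤ j := not_le.2 h
      simp [this, h.le, h.ne']

lemma sum_symm (c : Fin (n + 1) → Fin (n + 1) → ℝ) (hc : ∀ i j, c i j = c j i) :
    ∑ i, cmul (∑ j, c i j • eVbar j) (eV i) = (∑ i, c i i) • (one : CA n) := by
  have h1 : ∑ i, cmul (∑ j, c i j • eVbar j) (eV i)
      = ∑ i, ∑ j, c i j • (cmul (eVbar j) (eV i) : CA n) := by
    refine Finset.sum_congr rfl fun i _ => ?_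
    simp only [cmul_eq, map_sum, map_smul, LinearMap.sum_apply, LinearMap.smul_apply]
  have h2 : ∑ i, ∑ j, c i j • (cmul (eVbar j) (eV i) : CA n)
      = ∑ i, ∑ j, c i j • (cmul (eVbar i) (eV j) : CA n) := by
    rw [Finset.sum_comm]
    refine Finset.sum_congr rfl fun i _ => Finset.sum_congr rfl fun j _ => ?_
    rw [hc]
  have h3 : (2 : ℝ) • ∑ i, cmul (∑ j, c i j • eVbar j) (eV i)
      = (2 : ℝ) • ((∑ i, c i i) • (one : CA n)) := by
    rw [two_smul]
    conv_lhs => rw [h1]; arg 2; rw [h2]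
    simp only [← Finset.sum_add_distrib, ← smul_add, anticomm]
    simp [Finset.sum_smul, Finset.smul_sum, smul_comm (2 : ℝ)]
  exact smul_right_injective _ (two_ne_zero) h3

open scoped ContDiff

/-- The Euclidean square norm. -/
def sq (x : RV n) : ℝ := ∑ i, x i ^ 2

/-- The cut-off fundamental profile. -/
def V (n : ℕ) (ε s : ℝ) : ℝ := Real.smoothTransition (2 * s / ε ^ 2 - 1) * s ^ (-((n + 1 : ℝ) / 2))

/-- The profile of the kernel. -/
def K (n : ℕ) (ε s : ℝ) : ℝ := (n + 1 : ℝ) * V n ε s + 2 * (s * deriv (V n ε) s)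

/-- The mollifier (not normalised). -/
def ph (n : ℕ) (ε : ℝ) (x : RV n) : ℝ := K n ε (sq x)

lemma sq_nonneg' (x : RV n) : 0 ≤ sq x := Finset.sum_nonneg fun _ _ => _root_.sq_nonneg _

lemma sq_contDiff : ContDiff ℝ ∞ (sq : RV n → ℝ) := by
  unfold sq; fun_prop

lemma V_contDiff {ε : ℝ} (hε : 0 < ε) : ContDiff ℝ ∞ (V n ε) := by
  rw [contDiff_iff_contDiffAt]
  intro s
  rcases le_or_gt s 0 with hs | hs
  · have : V n ε =ᶠ[nhds s] fun _ => 0 := by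
      have : ∀ᶠ t in nhds s, t < ε ^ 2 / 2 := by
        apply eventually_lt_nhds
        exact hs.trans_lt (by positivity)
      filter_upwards [this] with t ht
      have : 2 * t / ε ^ 2 - 1 ≤ 0 := by
        rw [sub_nonpos, div_le_one (by positivity)]; linarith
      simp [V, Real.smoothTransition.zero_of_nonpos this]
    exact contDiffAt_const.congr_of_eventuallyEq this
  · unfold V
    apply ContDiffAt.mul
    · exact (Real.smoothTransition.contDiff (n := ⊤)).contDiffAt.comp s (by fun_prop)
    · exact Real.contDiffAt_rpow_const_of_ne hs.ne'

lemma V_eq {ε s : ℝ} (hε : 0 < ε) (hs : ε ^ 2 ≤ s) : V n ε s = s ^ (-((n + 1 : ℝ) / 2)) := by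
  have : 1 ≤ 2 * s / ε ^ 2 - 1 := by
    rw [le_sub_iff_add_le, le_div_iff₀ (by positivity)]; linarith
  simp [V, Real.smoothTransition.one_of_one_le this]

lemma K_contDiff {ε : ℝ} (hε : 0 < ε) : ContDiff ℝ ∞ (K n ε) := by
  have h := V_contDiff (n := n) hε
  have h' : ContDiff ℝ ∞ (deriv (V n ε)) := by
    exact ((contDiff_infty_iff_deriv).1 h).2
  unfold K
  fun_prop

lemma ph_contDiff {ε : ℝ} (hε : 0 < ε) : ContDiff ℝ ∞ (ph n ε) :=
  (K_contDiff hε).comp sq_contDiff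

lemma K_eq {ε s : ℝ} (hs : 0 < s) : K n ε s =
    4 / ε ^ 2 * (s * s ^ (-((n + 1 : ℝ) / 2))) * deriv Real.smoothTransition (2 * s / ε ^ 2 - 1) := by
  have h1 : HasDerivAt (fun s : ℝ => 2 * s / ε ^ 2 - 1) (2 / ε ^ 2) s := by
    simpa using (((hasDerivAt_id s).const_mul 2).div_const (ε ^ 2)).sub_const 1
  have hT : DifferentiableAt ℝ Real.smoothTransition (2 * s / ε ^ 2 - 1) :=
    (Real.smoothTransition.contDiff (n := 1)).differentiable (by norm_num) _
  have h2 := hT.hasDerivAt.comp s h1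
  have h3 : HasDerivAt (fun s : ℝ => s ^ (-((n + 1 : ℝ) / 2)))
      (-((n + 1 : ℝ) / 2) * s ^ (-((n + 1 : ℝ) / 2) - 1)) s :=
    Real.hasDerivAt_rpow_const (Or.inl hs.ne')
  have h4 : deriv (V n ε) s = _ := (h2.mul h3).deriv
  rw [K, h4, V, Real.rpow_sub_one hs.ne']
  simp only [Function.comp_apply]
  field_simp
  ring

lemma K_zero {ε : ℝ} : K n ε 0 = 0 := by
  simp [K, V, Real.smoothTransition.zero_of_nonpos]

lemma K_nonneg {ε s : ℝ} (hs : 0 ≤ s) : 0 ≤ K n ε s := by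
  rcases hs.eq_or_lt with rfl | hs
  · rw [K_zero]
  · rw [K_eq hs]
    have : 0 ≤ deriv Real.smoothTransition (2 * s / ε ^ 2 - 1) :=
      Real.smoothTransition.monotone.deriv_nonneg
    positivity

lemma K_supp {ε s : ℝ} (hε : 0 < ε) (hs : ε ^ 2 ≤ s) : K n ε s = 0 := by
  have h0 : 0 < s := lt_of_lt_of_le (by positivity) hs
  rw [K_eq h0]
  have h1 : 1 ≤ 2 * s / ε ^ 2 - 1 := by
    rw [le_sub_iff_add_le, le_div_iff₀ (by positivity)]; linarith
  have : IsLocalMax Real.smoothTransition (2 * s / ε ^ 2 - 1) := by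
    filter_upwards with t
    rw [Real.smoothTransition.one_of_one_le h1]
    exact Real.smoothTransition.le_one t
  rw [this.deriv_eq_zero, mul_zero]

lemma K_scale {ε s : ℝ} (hε : 0 < ε) (hs : 0 ≤ s) :
    K n ε s = (ε ^ (n + 1))⁻¹ * K n 1 (s / ε ^ 2) := by
  rcases hs.eq_or_lt with rfl | hs
  · simp [K_zero]
  · rw [K_eq hs, K_eq (by positivity), Real.div_rpow hs.le (by positivity)]
    have : (ε ^ 2) ^ (-((n + 1 : ℝ) / 2)) = (ε ^ (n + 1))⁻¹ := by
      rw [Real.rpow_neg (by positivity), ← Real.rpow_natCast, ← Real.rpow_mul hε.le,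
        ← Real.rpow_natCast]
      congr 2
      push_cast; ring
    rw [this]
    have e : 2 * (s / ε ^ 2) / 1 ^ 2 - 1 = 2 * s / ε ^ 2 - 1 := by ring
    rw [e]
    field_simp

lemma ph_scale {ε : ℝ} (hε : 0 < ε) (x : RV n) :
    ph n ε x = (ε ^ (n + 1))⁻¹ * ph n 1 (ε⁻¹ • x) := by
  rw [ph, ph, K_scale hε (sq_nonneg' x)]
  congr 2
  simp [sq, mul_pow, ← Finset.mul_sum]
  ring

lemma norm_sq_le (x : RV n) : ‖x‖ ^ 2 ≤ sq x := by
  have : ‖x‖ ≤ Real.sqrt (sq x) := by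
    rw [pi_norm_le_iff_of_nonneg (Real.sqrt_nonneg _)]
    intro i
    rw [Real.norm_eq_abs]
    apply Real.abs_le_sqrt
    exact Finset.single_le_sum (f := fun i => x i ^ 2) (fun i _ => _root_.sq_nonneg _)
      (Finset.mem_univ i)
  calc ‖x‖ ^ 2 ≤ Real.sqrt (sq x) ^ 2 := by gcongr
    _ = sq x := Real.sq_sqrt (sq_nonneg' x)

lemma ph_supp {ε : ℝ} (hε : 0 < ε) {x : RV n} (hx : ε ≤ ‖x‖) : ph n ε x = 0 := by
  apply K_supp hε
  refine le_trans ?_ (norm_sq_le x)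
  gcongr

lemma ph_compact {ε : ℝ} (hε : 0 < ε) : HasCompactSupport (ph n ε) := by
  apply HasCompactSupport.intro (isCompact_closedBall (0 : RV n) ε)
  intro x hx
  apply ph_supp hε
  simp at hx
  exact hx.le

lemma ph_even (ε : ℝ) (x : RV n) : ph n ε (-x) = ph n ε x := by
  simp [ph, sq]

lemma ph_int_one_pos : 0 < ∫ x, ph n 1 x := by
  obtain ⟨t, ht, h⟩ := exists_deriv_eq_slope Real.smoothTransition (zero_lt_one' ℝ)
    Real.smoothTransition.continuous.continuousOn
    ((Real.smoothTransition.contDiff (n := 1)).differentiable (by norm_num)).differentiableOn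
  simp at h
  have hs : 0 < (t + 1) / 2 := by linarith [ht.1]
  apply (ph_contDiff one_pos).continuous.integral_pos_of_hasCompactSupport_nonneg_nonzero
    (ph_compact one_pos) (x := Pi.single 0 (Real.sqrt ((t + 1) / 2)))
    (fun x => K_nonneg (sq_nonneg' x))
  have : sq (Pi.single 0 (Real.sqrt ((t + 1) / 2)) : RV n) = (t + 1) / 2 := by
    rw [sq, Finset.sum_eq_single 0]
    · rw [Pi.single_eq_same, Real.sq_sqrt hs.le]
    · intro i _ hi; simp [hi]
    · simp
  rw [ph, this, K_eq hs]
  have e : 2 * ((t + 1) / 2) / (1 : ℝ) ^ 2 - 1 = t := by ring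
  rw [e, h]
  positivity

lemma ph_int {ε : ℝ} (hε : 0 < ε) : ∫ x, ph n ε x = ∫ x, ph n 1 x := by
  simp_rw [ph_scale hε]
  rw [integral_const_mul, Measure.integral_comp_smul]
  simp
  rw [abs_of_pos hε]
  field_simp

lemma ph_bound : ∃ C : ℝ, ∀ ε > 0, ∀ x : RV n, |ph n ε x| ≤ C * (ε ^ (n + 1))⁻¹ := by
  obtain ⟨C, hC⟩ := (ph_compact (n := n) one_pos).exists_bound_of_continuous
    (ph_contDiff one_pos).continuous
  refine ⟨C, fun ε hε x => ?_⟩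
  have hp : 0 < (ε ^ (n + 1))⁻¹ := by positivity
  rw [ph_scale hε, abs_mul, mul_comm, abs_of_pos hp]
  exact mul_le_mul_of_nonneg_right (hC _) hp.le

/-- The profile of the test function. -/
def W (n : ℕ) (ε δ s : ℝ) : ℝ := V n ε s - V n δ s

/-- The test function `(x̄ - ȳ) W(|x-y|²)`. -/
def al (n : ℕ) (ε δ : ℝ) (y x : RV n) : CA n :=
  fun A => ∑ j, (W n ε δ (sq (x - y)) * (x j - y j)) * (eVbar j : CA n) A

lemma W_contDiff {ε δ : ℝ} (hε : 0 < ε) (hδ : 0 < δ) : ContDiff ℝ ∞ (W n ε δ) :=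
  (V_contDiff hε).sub (V_contDiff hδ)

lemma al_contDiff {ε δ : ℝ} (hε : 0 < ε) (hδ : 0 < δ) (y : RV n) :
    ContDiff ℝ ∞ (al n ε δ y) := by
  have h1 : ContDiff ℝ ∞ (fun x : RV n => W n ε δ (sq (x - y))) :=
    (W_contDiff hε hδ).comp (sq_contDiff.comp (contDiff_id.sub contDiff_const))
  unfold al
  fun_prop

lemma W_supp {ε δ : ℝ} (hε : 0 < ε) (hδ : 0 < δ) {x : RV n} (hx : max ε δ ≤ ‖x‖) :
    W n ε δ (sq x) = 0 := by
  have h1 : ε ^ 2 ≤ sq x := by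
    refine le_trans ?_ (norm_sq_le x)
    have := (le_max_left ε δ).trans hx
    gcongr
  have h2 : δ ^ 2 ≤ sq x := by
    refine le_trans ?_ (norm_sq_le x)
    have := (le_max_right ε δ).trans hx
    gcongr
  rw [W, V_eq hε h1, V_eq hδ h2, sub_self]

lemma isTest_of_zero {Ω : Set (RV n)} {α : RV n → CA n} (h : ContDiff ℝ ∞ α) {y : RV n} {r : ℝ}
    (hr : Metric.closedBall y r ⊆ Ω) (h0 : ∀ x, r < dist x y → α x = 0) : IsTest Ω α := by
  have h0' : ∀ x ∉ Metric.closedBall y r, α x = 0 := fun x hx => h0 x (by simpa using hx)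
  refine ⟨h, HasCompactSupport.intro (isCompact_closedBall y r) h0', ?_⟩
  refine (closure_minimal ?_ Metric.isClosed_closedBall).trans hr
  intro x hx
  by_contra hc
  exact hx (h0' x hc)

lemma al_test {Ω : Set (RV n)} {ε δ : ℝ} (hε : 0 < ε) (hδ : 0 < δ) {y : RV n}
    (h1 : Metric.closedBall y ε ⊆ Ω) (h2 : Metric.closedBall y δ ⊆ Ω) :
    IsTest Ω (al n ε δ y) := by
  have h : Metric.closedBall y (max ε δ) ⊆ Ω := by
    rcases max_choice ε δ with h | h <;> rw [h] <;> assumption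
  refine isTest_of_zero (al_contDiff hε hδ y) h fun x hx => ?_
  rw [dist_eq_norm] at hx
  funext A
  simp [al, W_supp hε hδ hx.le]

lemma sq_hasFDerivAt (y x : RV n) :
    HasFDerivAt (fun x : RV n => sq (x - y))
      (∑ i, (2 * (x i - y i)) • (ContinuousLinearMap.proj i : RV n →L[ℝ] ℝ)) x := by
  unfold sq
  apply HasFDerivAt.fun_sum
  intro i _
  have h : HasFDerivAt (fun x : RV n => x i - y i)
      (ContinuousLinearMap.proj i : RV n →L[ℝ] ℝ) x :=
    (ContinuousLinearMap.proj i : RV n →L[ℝ] ℝ).hasFDerivAt.sub_const _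
  simpa using h.pow 2

lemma al_pd {ε δ : ℝ} (hε : 0 < ε) (hδ : 0 < δ) (y x : RV n) (i : Fin (n + 1)) :
    pd (al n ε δ y) i x = ∑ j, ((if i = j then W n ε δ (sq (x - y)) else 0) +
      2 * (x i - y i) * (x j - y j) * deriv (W n ε δ) (sq (x - y))) • eVbar j := by
  funext A
  have hW : HasDerivAt (W n ε δ) (deriv (W n ε δ) (sq (x - y))) (sq (x - y)) :=
    ((W_contDiff hε hδ).differentiable (by simp) _).hasDerivAt
  have h1 := hW.comp_hasFDerivAt x (sq_hasFDerivAt y x)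
  have h2 : ∀ j, HasFDerivAt (fun x : RV n => x j - y j)
      (ContinuousLinearMap.proj j : RV n →L[ℝ] ℝ) x := fun j =>
    (ContinuousLinearMap.proj j : RV n →L[ℝ] ℝ).hasFDerivAt.sub_const _
  have h3 := HasFDerivAt.fun_sum (u := Finset.univ) fun j _ =>
    (h1.mul (h2 j)).mul_const ((eVbar j : CA n) A)
  have h4 : fderiv ℝ (fun x => al n ε δ y x A) x = _ := h3.fderiv
  rw [pd, h4]
  simp only [_root_.sum_apply, _root_.smul_apply,
    _root_.add_apply, ContinuousLinearMap.proj_apply, Finset.sum_apply,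
    Pi.smul_apply, smul_eq_mul, Function.comp_apply]
  refine Finset.sum_congr rfl fun j _ => ?_
  have e : ∑ k, 2 * (x k - y k) * (Pi.single i 1 : RV n) k = 2 * (x i - y i) := by
    rw [Finset.sum_eq_single i]
    · simp
    · intro k _ hk; simp [hk]
    · simp
  rw [e]
  by_cases hij : i = j
  · subst hij; simp; ring
  · simp [hij, Ne.symm hij]; ring

lemma al_dirac {ε δ : ℝ} (hε : 0 < ε) (hδ : 0 < δ) (y x : RV n) :
    DiracR (al n ε δ y) x = (ph n ε (y - x) - ph n δ (y - x)) • (one : CA n) := by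
  unfold DiracR
  simp_rw [al_pd hε hδ]
  rw [sum_symm]
  · congr 1
    rw [← neg_sub x y, ph_even, ph_even, ph, ph, K, K]
    have : deriv (W n ε δ) (sq (x - y)) = deriv (V n ε) (sq (x - y)) - deriv (V n δ) (sq (x - y)) :=
      deriv_sub ((V_contDiff hε).differentiable (by simp) _)
        ((V_contDiff hδ).differentiable (by simp) _)
    rw [Finset.sum_add_distrib, ← Finset.sum_mul, this]
    have e : ∑ i, 2 * (x i - y i) * (x i - y i) = 2 * sq (x - y) := by
      rw [sq, Finset.mul_sum]
      refine Finset.sum_congr rfl fun i _ => ?_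
      simp; ring
    rw [e]
    simp [W]
    ring
  · intro i j
    by_cases hij : i = j
    · subst hij; rfl
    · rw [if_neg hij, if_neg (Ne.symm hij)]; ring

lemma cmul_smul_one (c : ℝ) (a : CA n) : cmul (c • one) a = c • a := by
  rw [cmul_eq, map_smul, LinearMap.smul_apply, ← cmul_eq, one_cmul]

/-- The mollification of `f`. -/
def mol (Ω : Set (RV n)) (f : RV n → CA n) (ε : ℝ) (y : RV n) : CA n :=
  ∫ x in Ω, ph n ε (y - x) • f x

lemma integrableOn_smul {Ω : Set (RV n)} {f : RV n → CA n} (hloc : LocallyIntegrableOn f Ω)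
    {y : RV n} {r : ℝ} (hr : Metric.closedBall y r ⊆ Ω) {φ : RV n → ℝ} (hφ : Continuous φ)
    (h0 : ∀ x, r < dist x y → φ x = 0) : Integrable (fun x => φ x • f x) := by
  have h1 : IntegrableOn f (Metric.closedBall y r) :=
    hloc.integrableOn_compact_subset hr (isCompact_closedBall y r)
  have h2 := h1.continuousOn_smul hφ.continuousOn (isCompact_closedBall y r)
  refine (integrableOn_iff_integrable_of_support_subset ?_).1 h2
  intro x hx
  by_contra hc
  apply hx
  simp [h0 x (by simpa using hc)]

lemma ph_shift_zero {ε : ℝ} (hε : 0 < ε) (y x : RV n) (hx : ε < dist x y) :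
    ph n ε (y - x) = 0 := by
  apply ph_supp hε
  rw [← dist_eq_norm, dist_comm]; exact hx.le

lemma ph_shift_cont {ε : ℝ} (hε : 0 < ε) (y : RV n) :
    ContDiff ℝ ∞ (fun x => ph n ε (y - x)) :=
  (ph_contDiff hε).comp (contDiff_const.sub contDiff_id)

lemma mol_eq {Ω : Set (RV n)} {f : RV n → CA n} (hloc : LocallyIntegrableOn f Ω)
    (hweak : ∀ α : RV n → CA n, IsTest Ω α →
      ∫ x in Ω, CA.cmul (DiracR α x) (f x) = 0)
    {ε δ : ℝ} (hε : 0 < ε) (hδ : 0 < δ) {y : RV n}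
    (h1 : Metric.closedBall y ε ⊆ Ω) (h2 : Metric.closedBall y δ ⊆ Ω) :
    mol Ω f ε y = mol Ω f δ y := by
  have h := hweak _ (al_test hε hδ h1 h2)
  simp_rw [al_dirac hε hδ, cmul_smul_one, sub_smul] at h
  rw [integral_sub] at h
  · exact sub_eq_zero.1 h
  · exact (integrableOn_smul hloc h1 (ph_shift_cont hε y).continuous
      (ph_shift_zero hε y)).integrableOn
  · exact (integrableOn_smul hloc h2 (ph_shift_cont hδ y).continuous
      (ph_shift_zero hδ y)).integrableOn

lemma ae_tendsto_mol {F : RV n → CA n} (hF : LocallyIntegrable F) :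
    ∀ᵐ y : RV n, Filter.Tendsto
      (fun δ : ℝ => ∫ x, ((∫ z, ph n 1 z)⁻¹ * ph n δ (y - x)) • F x)
      (nhdsWithin 0 (Set.Ioi 0)) (nhds (F y)) := by
  obtain ⟨C, hC⟩ := ph_bound (n := n)
  have hc := ph_int_one_pos (n := n)
  filter_upwards [(Besicovitch.vitaliFamily (volume : Measure (RV n))).ae_tendsto_average_norm_sub
    hF] with y hy
  have h1 := hy.comp (Besicovitch.tendsto_filterAt volume y)
  apply tendsto_integral_smul_of_tendsto_average_norm_sub
    ((∫ z, ph n 1 z)⁻¹ * C * 2 ^ (n + 1)) h1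
  · filter_upwards with δ using hF.integrableOn_isCompact (isCompact_closedBall _ _)
  · apply tendsto_const_nhds.congr'
    filter_upwards [self_mem_nhdsWithin] with δ hδ
    rw [integral_const_mul, integral_sub_left_eq_self (fun x => ph n δ x), ph_int hδ,
      inv_mul_cancel₀ hc.ne']
  · filter_upwards [self_mem_nhdsWithin] with δ hδ
    intro x hx
    by_contra hxc
    apply hx
    have : ph n δ (y - x) = 0 := ph_shift_zero hδ y x (by simpa using hxc)
    simp [this]
  · filter_upwards [self_mem_nhdsWithin] with δ hδ
    intro x
    have hδ' : (0 : ℝ) < δ := hδ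
    have hv : (volume : Measure (RV n)).real (Metric.closedBall y δ) = (2 * δ) ^ (n + 1) := by
      rw [Measure.real, Real.volume_pi_closedBall _ hδ'.le, ENNReal.toReal_ofReal (by positivity)]
      simp
    rw [hv, abs_mul, abs_of_pos (inv_pos.2 hc), mul_pow]
    calc (∫ z, ph n 1 z)⁻¹ * |ph n δ (y - x)| ≤ (∫ z, ph n 1 z)⁻¹ * (C * (δ ^ (n + 1))⁻¹) := by
          have := inv_pos.2 hc
          gcongr
          exact hC δ hδ' _
      _ = _ := by field_simp

lemma dirac_scalar (ψ : RV n → ℝ) (x : RV n) (hψ : DifferentiableAt ℝ ψ x) :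
    DiracR (fun x => ψ x • (one : CA n)) x = ∑ i, (fderiv ℝ ψ x (Pi.single i 1)) • eV i := by
  unfold DiracR
  refine Finset.sum_congr rfl fun i _ => ?_
  have : pd (fun x => ψ x • (one : CA n)) i x = (fderiv ℝ ψ x (Pi.single i 1)) • one := by
    funext A
    have h : fderiv ℝ (fun x => (ψ x • (one : CA n)) A) x = _ :=
      (hψ.hasFDerivAt.mul_const ((one : CA n) A)).fderiv
    rw [pd, h]
    simp [mul_comm]
  rw [this, cmul_smul_one]

open scoped Convolution

/-- The bilinear map `(a, r) ↦ r • a`. -/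
abbrev LL (n : ℕ) : CA n →L[ℝ] ℝ →L[ℝ] CA n := (ContinuousLinearMap.lsmul ℝ ℝ).flip

/-- the local representative -/
def G (F : RV n → CA n) (r : ℝ) : RV n → CA n := F ⋆[LL n, volume] ph n r

lemma G_apply (F : RV n → CA n) (r : ℝ) (y : RV n) : G F r y = ∫ x, ph n r (y - x) • F x := rfl

lemma G_contDiff {F : RV n → CA n} (hF : LocallyIntegrable F) {r : ℝ} (hr : 0 < r) :
    ContDiff ℝ ∞ (G F r) :=
  (ph_compact hr).contDiff_convolution_right (LL n) hF (ph_contDiff hr)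

lemma G_pd {F : RV n → CA n} (hF : LocallyIntegrable F) {r : ℝ} (hr : 0 < r) (y : RV n)
    (i : Fin (n + 1)) :
    pd (G F r) i y = ∫ x, (fderiv ℝ (ph n r) (y - x) (Pi.single i 1)) • F x := by
  have hd := (ph_compact hr).hasFDerivAt_convolution_right (LL n) hF
    ((ph_contDiff hr).of_le (by exact_mod_cast le_top)) y
  have h1 : pd (G F r) i y = fderiv ℝ (G F r) y (Pi.single i 1) := by
    funext A
    have h : HasFDerivAt (G F r) (fderiv ℝ (G F r) y) y :=
      ((G_contDiff hF hr).differentiable (by simp) y).hasFDerivAt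
    rw [pd, (hasFDerivAt_pi'.1 h A).fderiv]
    rfl
  have h2 : fderiv ℝ (G F r) y = _ := hd.fderiv
  rw [h1, h2, convolution_precompR_apply (LL n) hF ((ph_compact hr).fderiv ℝ)
    ((ph_contDiff hr).continuous_fderiv (by simp))]
  rfl

lemma pd_congr {F H : RV n → CA n} {x : RV n} (h : F =ᶠ[nhds x] H) (i : Fin (n + 1)) :
    pd F i x = pd H i x := by
  funext A
  have : (fun y => F y A) =ᶠ[nhds x] (fun y => H y A) := h.mono fun y hy => congrFun hy A
  rw [pd, pd, this.fderiv_eq]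

lemma dirac_congr {F H : RV n → CA n} {x : RV n} (h : F =ᶠ[nhds x] H) :
    DiracL F x = DiracL H x := by
  unfold DiracL
  exact Finset.sum_congr rfl fun i _ => by rw [pd_congr h]

lemma pd_smul (c : ℝ) (F : RV n → CA n) (x : RV n) (hF : DifferentiableAt ℝ F x)
    (i : Fin (n + 1)) : pd (fun y => c • F y) i x = c • pd F i x := by
  funext A
  have hA : DifferentiableAt ℝ (fun y => F y A) x := (differentiableAt_pi.1 hF) A
  have h : fderiv ℝ (fun y => (c • F y) A) x = _ := (hA.hasFDerivAt.const_mul c).fderiv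
  rw [pd, h]
  simp [pd]

lemma dirac_smul (c : ℝ) (F : RV n → CA n) (x : RV n) (hF : DifferentiableAt ℝ F x) :
    DiracL (fun y => c • F y) x = c • DiracL F x := by
  unfold DiracL
  simp_rw [pd_smul c F x hF, cmul_eq, map_smul, Finset.smul_sum]

/-- The truncation of `f` to a ball. -/
def trunc (f : RV n → CA n) (y₀ : RV n) (r : ℝ) : RV n → CA n :=
  (Metric.closedBall y₀ (2 * r)).indicator f

lemma trunc_int {Ω : Set (RV n)} {f : RV n → CA n} (hloc : LocallyIntegrableOn f Ω)
    {y₀ : RV n} {r : ℝ} (h : Metric.closedBall y₀ (2 * r) ⊆ Ω) : Integrable (trunc f y₀ r) :=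
  (hloc.integrableOn_compact_subset h (isCompact_closedBall _ _)).integrable_indicator
    Metric.isClosed_closedBall.measurableSet

/-- Changing between `f` on `Ω` and its truncation. -/
lemma smul_trunc {Ω : Set (RV n)} {f : RV n → CA n}
    {y₀ y : RV n} {r δ : ℝ} (h : Metric.closedBall y₀ (2 * r) ⊆ Ω) (hy : dist y y₀ < r)
    (hδ : δ ≤ r) (φ : RV n → ℝ) (h0 : ∀ x, δ < dist x y → φ x = 0) :
    (fun x => φ x • trunc f y₀ r x) = Ω.indicator (fun x => φ x • f x) := by
  funext x
  by_cases hx : δ < dist x y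
  · simp [Set.indicator, h0 x hx]
  · have hx' : x ∈ Metric.closedBall y₀ (2 * r) := by
      have := dist_triangle x y y₀
      simp only [Metric.mem_closedBall]; linarith
    rw [trunc, Set.indicator_of_mem hx', Set.indicator_of_mem (h hx')]

lemma ball_sub {Ω : Set (RV n)}
    {y₀ y : RV n} {r δ : ℝ} (h : Metric.closedBall y₀ (2 * r) ⊆ Ω) (hy : dist y y₀ < r)
    (hδ : δ ≤ r) : Metric.closedBall y δ ⊆ Ω := by
  refine (Metric.closedBall_subset_closedBall' ?_).trans h
  linarith

lemma G_eq_mol {Ω : Set (RV n)} (hΩ : IsOpen Ω) {f : RV n → CA n}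
    {y₀ y : RV n} {r δ : ℝ} (h : Metric.closedBall y₀ (2 * r) ⊆ Ω) (hy : dist y y₀ < r)
    (h0 : 0 < δ) (hδ : δ ≤ r) :
    G (trunc f y₀ r) δ y = mol Ω f δ y := by
  rw [G_apply, smul_trunc h hy hδ _ (ph_shift_zero h0 y), integral_indicator hΩ.measurableSet, mol]

lemma G_dirac {Ω : Set (RV n)} (hΩ : IsOpen Ω) {f : RV n → CA n} (hloc : LocallyIntegrableOn f Ω)
    (hweak : ∀ α : RV n → CA n, IsTest Ω α →
      ∫ x in Ω, CA.cmul (DiracR α x) (f x) = 0)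
    {y₀ y : RV n} {r : ℝ} (hr : 0 < r) (h : Metric.closedBall y₀ (2 * r) ⊆ Ω)
    (hy : dist y y₀ < r) : DiracL (G (trunc f y₀ r) r) y = 0 := by
  have hF := (trunc_int hloc h).locallyIntegrable
  have hb := ball_sub h hy le_rfl
  set ψ : RV n → ℝ := fun x => ph n r (y - x) with hψ
  have hψc : ContDiff ℝ ∞ ψ := ph_shift_cont hr y
  have htest : IsTest Ω (fun x => ψ x • (one : CA n)) := by
    refine isTest_of_zero (by fun_prop) hb fun x hx => ?_
    simp [hψ, ph_shift_zero hr y x hx]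
  have hw := hweak _ htest
  have hfd : ∀ x v, fderiv ℝ ψ x v = - fderiv ℝ (ph n r) (y - x) v := by
    intro x v
    have h1 : HasFDerivAt (ph n r) (fderiv ℝ (ph n r) (y - x)) (y - x) :=
      ((ph_contDiff hr).differentiable (by simp) _).hasFDerivAt
    have h2 : HasFDerivAt (fun x : RV n => y - x) (-ContinuousLinearMap.id ℝ (RV n)) x :=
      (hasFDerivAt_id x).const_sub y
    have h3 : fderiv ℝ ψ x = _ := (h1.comp x h2).fderiv
    rw [h3]; simp
  -- the kernels
  have hk0 : ∀ i : Fin (n + 1), ∀ x, r < dist x y →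
      fderiv ℝ (ph n r) (y - x) (Pi.single i 1) = 0 := by
    intro i x hx
    have : ph n r =ᶠ[nhds (y - x)] fun _ => 0 := by
      have : ∀ᶠ z : RV n in nhds (y - x), r < ‖z‖ := by
        apply continuous_norm.continuousAt.eventually_const_lt
        rw [dist_comm, dist_eq_norm] at hx
        exact hx
      filter_upwards [this] with z hz using ph_supp hr hz.le
    rw [this.fderiv_eq]; simp
  have hkc : ∀ i : Fin (n + 1), Continuous
      (fun x => fderiv ℝ (ph n r) (y - x) (Pi.single i 1)) := by
    intro i
    have := (ph_contDiff (n := n) hr).continuous_fderiv (by simp)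
    fun_prop
  have hki : ∀ i : Fin (n + 1), Integrable
      (fun x => fderiv ℝ (ph n r) (y - x) (Pi.single i 1) • f x) := fun i =>
    integrableOn_smul hloc hb (hkc i) (hk0 i)
  have e1 : ∀ i, cmul (eV i) (pd (G (trunc f y₀ r) r) i y)
      = ∫ x in Ω, cmul (eV i) (fderiv ℝ (ph n r) (y - x) (Pi.single i 1) • f x) := by
    intro i
    rw [G_pd hF hr, smul_trunc h hy le_rfl _ (hk0 i), integral_indicator hΩ.measurableSet]
    exact ((LinearMap.toContinuousLinearMap (cmulL (eV i))).integral_comp_comm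
      (hki i).integrableOn).symm
  unfold DiracL
  simp_rw [e1]
  rw [← integral_finsetSum]
  · rw [← neg_eq_zero, ← integral_neg, ← hw]
    congr 1
    funext x
    rw [dirac_scalar ψ x (hψc.differentiable (by simp) x)]
    simp_rw [hfd, cmul_eq, map_sum, map_smul, LinearMap.sum_apply, LinearMap.smul_apply]
    simp
  · intro i _
    exact ((LinearMap.toContinuousLinearMap (cmulL (eV i))).integrable_comp
      (hki i).integrableOn)

end WM

theorem weak_monogenic_is_smooth {n : ℕ} (hn : 1 ≤ n) (Ω : Set (RV n)) (hΩ : IsOpen Ω)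
    (f : RV n → CA n) (hloc : LocallyIntegrableOn f Ω)
    (hweak : ∀ α : RV n → CA n, IsTest Ω α →
      ∫ x in Ω, CA.cmul (DiracR α x) (f x) = 0) :
    ∃ g : RV n → CA n, ContDiffOn ℝ (⊤ : ℕ∞) g Ω ∧ (∀ x ∈ Ω, DiracL g x = 0) ∧
      f =ᵐ[volume.restrict Ω] g := by
  classical
  have hc := WM.ph_int_one_pos (n := n)
  set c : ℝ := (∫ z, WM.ph n 1 z)⁻¹ with hcdef
  have hex : ∀ y : RV n, ∃ r : ℝ, y ∈ Ω → 0 < r ∧ Metric.closedBall y r ⊆ Ω := by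
    intro y
    by_cases hy : y ∈ Ω
    · obtain ⟨r, hr, h⟩ := Metric.nhds_basis_closedBall.mem_iff.1 (hΩ.mem_nhds hy)
      exact ⟨r, fun _ => ⟨hr, h⟩⟩
    · exact ⟨0, fun h => absurd h hy⟩
  choose rad hrad using hex
  let g : RV n → CA n := fun y => c • WM.mol Ω f (rad y) y
  -- local data
  have hloc' : ∀ y₀ ∈ Ω, ∃ r : ℝ, 0 < r ∧ Metric.closedBall y₀ (2 * r) ⊆ Ω := by
    intro y₀ hy
    refine ⟨rad y₀ / 2, half_pos (hrad y₀ hy).1, ?_⟩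
    rw [mul_div_cancel₀ _ two_ne_zero]
    exact (hrad y₀ hy).2
  have hmem : ∀ {y₀ y : RV n} {r : ℝ}, 0 < r → Metric.closedBall y₀ (2 * r) ⊆ Ω →
      dist y y₀ < r → y ∈ Ω := by
    intro y₀ y r hr h hy
    exact WM.ball_sub h hy hr.le (by simp)
  have hg : ∀ {y₀ y : RV n} {r δ : ℝ}, 0 < r → Metric.closedBall y₀ (2 * r) ⊆ Ω →
      dist y y₀ < r → 0 < δ → δ ≤ r → g y = c • WM.G (WM.trunc f y₀ r) δ y := by
    intro y₀ y r δ hr h hy hδ hδr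
    have hyΩ := hmem hr h hy
    rw [WM.G_eq_mol hΩ h hy hδ hδr, WM.mol_eq hloc hweak hδ (hrad y hyΩ).1
      (WM.ball_sub h hy hδr) (hrad y hyΩ).2]
  have hgG : ∀ {y₀ : RV n} {r : ℝ}, 0 < r → Metric.closedBall y₀ (2 * r) ⊆ Ω →
      g =ᶠ[nhds y₀] fun y => c • WM.G (WM.trunc f y₀ r) r y := by
    intro y₀ r hr h
    filter_upwards [Metric.ball_mem_nhds y₀ hr] with y hy
    exact hg hr h hy hr le_rfl
  refine ⟨g, ?_, ?_, ?_⟩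
  · intro y₀ hy₀
    obtain ⟨r, hr, h⟩ := hloc' y₀ hy₀
    have hF := (WM.trunc_int hloc h).locallyIntegrable
    have h1 := (WM.G_contDiff hF hr).const_smul c
    exact (h1.contDiffAt.congr_of_eventuallyEq (hgG hr h)).contDiffWithinAt
  · intro y₀ hy₀
    obtain ⟨r, hr, h⟩ := hloc' y₀ hy₀
    have hF := (WM.trunc_int hloc h).locallyIntegrable
    rw [WM.dirac_congr (hgG hr h),
      WM.dirac_smul c _ _ ((WM.G_contDiff hF hr).differentiable (by simp) y₀),
      WM.G_dirac hΩ hloc hweak hr h (by simpa using hr), smul_zero]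
  · rw [Filter.EventuallyEq, ae_restrict_iff' hΩ.measurableSet, ae_iff]
    apply measure_null_of_locally_null
    intro y₀ hy₀
    have hy₀Ω : y₀ ∈ Ω := by
      by_contra hn'
      exact hy₀ fun h => absurd h hn'
    obtain ⟨r, hr, h⟩ := hloc' y₀ hy₀Ω
    have hF := (WM.trunc_int hloc h).locallyIntegrable
    refine ⟨_, Filter.inter_mem self_mem_nhdsWithin
      (mem_nhdsWithin_of_mem_nhds (Metric.ball_mem_nhds y₀ hr)), ?_⟩
    have hae := WM.ae_tendsto_mol hF
    refine measure_mono_null ?_ (ae_iff.1 hae)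
    rintro y ⟨hy1, hy2⟩ ht
    apply hy1
    intro _
    have hlim : Filter.Tendsto (fun δ : ℝ => ∫ x, (c * WM.ph n δ (y - x)) • WM.trunc f y₀ r x)
        (nhdsWithin 0 (Set.Ioi 0)) (nhds (g y)) := by
      apply tendsto_const_nhds.congr'
      filter_upwards [Ioc_mem_nhdsGT hr] with δ hδ
      rw [hg hr h hy2 hδ.1 hδ.2, WM.G_apply, ← integral_smul]
      simp_rw [smul_smul]
    have := tendsto_nhds_unique ht hlim
    rw [← this, WM.trunc, Set.indicator_of_mem]
    have hy2' : dist y y₀ < r := hy2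
    simp only [Metric.mem_closedBall]; linarith

end
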